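/- Let P = (X, Y, R) be a polarity and T ⊆ X × Y a relation such that for every x ∈ X the section T[x, −] = {y ∈ Y : x T y} is a stable subset of Y and for every y ∈ Y the section T[−, y] = {x ∈ X : x T y} is a stable subset of X. Then ◇ is left adjoint to □ on the stable set lattice: for all stable A, B ⊆ X, ◇A ⊆ B if and only if A ⊆ □B. Consequently, on the complete lattice P⁺ of stable subsets of X, ◇ preserves arbitrary joins (it is a complete normal operator) and □ preserves arbitrary meets (it is a complete normal dual operator). -/

import Mathlib

open FirstOrder FirstOrder.Language FirstOrder.Language.Structure

namespace PaperCore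

/-! ### Typed polarities and stable set lattices -/

section Pol
variable {X Y : Type*}

def rho (R : X → Y → Prop) (A : Set X) : Set Y := {y | ∀ x ∈ A, R x y}

def lam (R : X → Y → Prop) (B : Set Y) : Set X := {x | ∀ y ∈ B, R x y}

def IsStable (R : X → Y → Prop) (A : Set X) : Prop := lam R (rho R A) ⊆ A

def IsStableY (R : X → Y → Prop) (B : Set Y) : Prop := rho R (lam R B) ⊆ B

lemma rho_anti {R : X → Y → Prop} {A B : Set X} (h : A ⊆ B) : rho R B ⊆ rho R A :=
  fun y hy x hx => hy x (h hx)

lemma lam_anti {R : X → Y → Prop} {B B' : Set Y} (h : B ⊆ B') : lam R B' ⊆ lam R B :=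
  fun x hx y hy => hx y (h hy)

lemma lamrho_mono {R : X → Y → Prop} {A B : Set X} (h : A ⊆ B) :
    lam R (rho R A) ⊆ lam R (rho R B) := lam_anti (rho_anti h)

def Stable (R : X → Y → Prop) : Type _ := {A : Set X // IsStable R A}

namespace Stable

variable {R : X → Y → Prop}

instance : PartialOrder (Stable R) :=
  inferInstanceAs (PartialOrder {A : Set X // IsStable R A})

lemma le_def {A B : Stable R} : A ≤ B ↔ A.1 ⊆ B.1 := Iff.rfl

instance : InfSet (Stable R) :=
  ⟨fun S => ⟨⋂ A ∈ S, A.1, fun x hx => Set.mem_iInter₂.2 fun A hA =>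
    A.2 (lamrho_mono (Set.biInter_subset_of_mem hA) hx)⟩⟩

instance : CompleteLattice (Stable R) :=
  completeLatticeOfInf _ (fun S =>
    ⟨fun A hA => Set.biInter_subset_of_mem hA,
     fun B hB => Set.subset_iInter₂ fun A hA => hB hA⟩)

end Stable
end Pol

/-! ### Ultraproducts of indexed families (as plain quotients) -/

section UProd
variable {I : Type*}

def uSetoid (U : Ultrafilter I) (β : I → Type*) : Setoid (∀ i, β i) where
  r f g := {i | f i = g i} ∈ U
  iseqv := by
    refine ⟨fun f => ?_, fun {f g} h => ?_, fun {f g h} h1 h2 => ?_⟩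
    · exact Filter.univ_mem' (fun i => rfl)
    · exact Filter.mem_of_superset h fun i hi => (hi : f i = g i).symm
    · exact Filter.mem_of_superset (Filter.inter_mem h1 h2) fun i hi =>
        (hi.1 : f i = g i).trans hi.2

def UProd (U : Ultrafilter I) (β : I → Type*) : Type _ := Quotient (uSetoid U β)

def uMk (U : Ultrafilter I) {β : I → Type*} (f : ∀ i, β i) : UProd U β :=
  Quotient.mk (uSetoid U β) f

lemma uMk_surjective (U : Ultrafilter I) (β : I → Type*) :
    Function.Surjective (uMk U (β := β)) := Quotient.mk''_surjective

/-- `θ(α^U)`: the subset of the ultraproduct determined by a family of subsets. -/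
def thetaSet (U : Ultrafilter I) {β : I → Type*} (α : ∀ i, Set (β i)) : Set (UProd U β) :=
  fun m => Quotient.liftOn m (fun f => {i | f i ∈ α i} ∈ U) (by
    intro f g hfg
    refine propext ⟨fun hf => ?_, fun hg => ?_⟩
    · exact Filter.mem_of_superset (Filter.inter_mem hf hfg) fun i hi =>
        show g i ∈ α i from hi.2 ▸ hi.1
    · exact Filter.mem_of_superset (Filter.inter_mem hg hfg) fun i hi =>
        show f i ∈ α i from hi.2.symm ▸ hi.1)

lemma mem_thetaSet (U : Ultrafilter I) {β : I → Type*} (α : ∀ i, Set (β i)) (f : ∀ i, β i) :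
    uMk U f ∈ thetaSet U α ↔ {i | f i ∈ α i} ∈ U := Iff.rfl

end UProd

/-! ### Completions: closed/open elements, density, compactness -/

section Completion
variable {C : Type*} [CompleteLattice C]

def ClosedElt (img : Set C) (c : C) : Prop := ∃ S ⊆ img, c = sInf S

def OpenElt (img : Set C) (c : C) : Prop := ∃ S ⊆ img, c = sSup S

/-- The completion with image `img` is dense. -/
def DenseCompletion (img : Set C) : Prop :=
  ∀ x : C, (∃ G, (∀ c ∈ G, ClosedElt img c) ∧ x = sSup G) ∧
    (∃ G, (∀ o ∈ G, OpenElt img o) ∧ x = sInf G)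

/-- The completion with image `img` is compact. -/
def CompactCompletion (img : Set C) : Prop :=
  ∀ S T : Set C, (∀ c ∈ S, ClosedElt img c) → (∀ o ∈ T, OpenElt img o) →
    sInf S ≤ sSup T →
      ∃ S' T' : Finset C, ↑S' ⊆ S ∧ ↑T' ⊆ T ∧ sInf (S' : Set C) ≤ sSup (T' : Set C)

def JoinDense (img : Set C) : Prop := ∀ x : C, ∃ G ⊆ img, x = sSup G

def MeetDense (img : Set C) : Prop := ∀ x : C, ∃ G ⊆ img, x = sInf G

/-! Canonical and MacNeille extensions of `n`-ary isotone maps. -/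

variable {L : Type*}

def lowerCanExt {n : ℕ} (η : L → C) (g : (Fin n → L) → L) (x : Fin n → C) : C :=
  sSup {z | ∃ p : Fin n → C, (∀ j, ClosedElt (Set.range η) (p j)) ∧ (∀ j, p j ≤ x j) ∧
    z = sInf {w | ∃ a : Fin n → L, (∀ j, p j ≤ η (a j)) ∧ w = η (g a)}}

def upperCanExt {n : ℕ} (η : L → C) (g : (Fin n → L) → L) (x : Fin n → C) : C :=
  sInf {z | ∃ q : Fin n → C, (∀ j, OpenElt (Set.range η) (q j)) ∧ (∀ j, x j ≤ q j) ∧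
    z = sSup {w | ∃ a : Fin n → L, (∀ j, η (a j) ≤ q j) ∧ w = η (g a)}}

def lowerMacExt {n : ℕ} (η : L → C) (g : (Fin n → L) → L) (x : Fin n → C) : C :=
  sSup {w | ∃ a : Fin n → L, (∀ j, η (a j) ≤ x j) ∧ w = η (g a)}

def upperMacExt {n : ℕ} (η : L → C) (g : (Fin n → L) → L) (x : Fin n → C) : C :=
  sInf {w | ∃ a : Fin n → L, (∀ j, x j ≤ η (a j)) ∧ w = η (g a)}

/-- `F` preserves arbitrary joins (including the empty join) in each coordinate. -/
def CompleteNormalOp {n : ℕ} (F : (Fin n → C) → C) : Prop :=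
  ∀ (as : Fin n → C) (j : Fin n) (G : Set C),
    F (Function.update as j (sSup G)) = ⨆ B ∈ G, F (Function.update as j B)

/-- `F` preserves arbitrary meets (including the empty meet) in each coordinate. -/
def CompleteNormalDualOp {n : ℕ} (F : (Fin n → C) → C) : Prop :=
  ∀ (as : Fin n → C) (j : Fin n) (G : Set C),
    F (Function.update as j (sInf G)) = ⨅ B ∈ G, F (Function.update as j B)

end Completion

/-! ### First-order polarity-based structures and definable operations -/

section FO

/-- The language with `n` fresh unary relation symbols `S₀, …, S_{n-1}`. -/
def unaryLang (n : ℕ) : FirstOrder.Language where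
  Functions := fun _ => Empty
  Relations := fun k => match k with
    | 1 => Fin n
    | _ => Empty

/-- The structure interpreting each `Sₘ` as `A m`. -/
def unaryStructure {M : Type*} {n : ℕ} (A : Fin n → Set M) : (unaryLang n).Structure M where
  funMap := fun {k} f _ => f.elim
  RelMap := fun {k} => match k with
    | 0 => fun r _ => r.elim
    | 1 => fun r v => v 0 ∈ A r
    | (_ + 2) => fun r _ => r.elim

/-- The expansion `⟨P, A₀, …, A_{n-1}⟩` of a structure by `n` set parameters. -/
def withParams {L : FirstOrder.Language} {M : Type*} [L.Structure M] {n : ℕ}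
    (A : Fin n → Set M) : (L.sum (unaryLang n)).Structure M :=
  letI := unaryStructure A
  inferInstance

variable {L : FirstOrder.Language} {M : Type*} [L.Structure M]

def pX (Xb : L.Relations 1) (M : Type*) [L.Structure M] : Set M := {m | RelMap Xb ![m]}

def pR (Rb : L.Relations 2) : M → M → Prop := fun a b => RelMap Rb ![a, b]

/-- The operation on subsets of `X` defined by a formula `φ(v)` of `𝓛*_n`:
`f^P_φ(A₀,…,A_{n-1}) = {x ∈ X : ⟨P, A⟩ ⊨ φ[x]}`. -/
def defOp (Xb : L.Relations 1) {n : ℕ}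
    (φ : (L.sum (unaryLang n)).Formula (Fin 1)) (A : Fin n → Set M) : Set M :=
  {x | x ∈ pX Xb M ∧ @Formula.Realize _ M (withParams A) _ φ (fun _ => x)}

/-- Set-based polarity data inside a one-sorted universe. -/
def rhoS (Yset : Set M) (R : M → M → Prop) (A : Set M) : Set M :=
  {y | y ∈ Yset ∧ ∀ x ∈ A, R x y}

def lamS (Xset : Set M) (R : M → M → Prop) (B : Set M) : Set M :=
  {x | x ∈ Xset ∧ ∀ y ∈ B, R x y}

def IsStableS (Xset Yset : Set M) (R : M → M → Prop) (A : Set M) : Prop :=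
  A ⊆ Xset ∧ lamS Xset R (rhoS Yset R A) ⊆ A

def StableS (Xset Yset : Set M) (R : M → M → Prop) : Type _ :=
  {A : Set M // IsStableS Xset Yset R A}

namespace StableS

variable {Xset Yset : Set M} {R : M → M → Prop}

lemma lamS_subset (B : Set M) : lamS Xset R B ⊆ Xset := fun _ hx => hx.1

lemma rhoS_anti {A B : Set M} (h : A ⊆ B) : rhoS Yset R B ⊆ rhoS Yset R A :=
  fun y hy => ⟨hy.1, fun x hx => hy.2 x (h hx)⟩

lemma lamS_anti {B B' : Set M} (h : B ⊆ B') : lamS Xset R B' ⊆ lamS Xset R B :=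
  fun x hx => ⟨hx.1, fun y hy => hx.2 y (h hy)⟩

lemma lamrhoS_mono {A B : Set M} (h : A ⊆ B) :
    lamS Xset R (rhoS Yset R A) ⊆ lamS Xset R (rhoS Yset R B) :=
  lamS_anti (rhoS_anti (Yset := Yset) h)

instance : PartialOrder (StableS Xset Yset R) :=
  inferInstanceAs (PartialOrder {A : Set M // IsStableS Xset Yset R A})

lemma le_def {A B : StableS Xset Yset R} : A ≤ B ↔ A.1 ⊆ B.1 := Iff.rfl

instance : InfSet (StableS Xset Yset R) :=
  ⟨fun S => ⟨Xset ∩ ⋂ A ∈ S, A.1,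
    ⟨Set.inter_subset_left, fun x hx =>
      ⟨(lamS_subset _) hx, Set.mem_iInter₂.2 fun A hA =>
        A.2.2 (lamrhoS_mono (Set.inter_subset_right.trans (Set.biInter_subset_of_mem hA)) hx)⟩⟩⟩⟩

instance : CompleteLattice (StableS Xset Yset R) :=
  completeLatticeOfInf _ (fun S =>
    ⟨fun A hA => (Set.inter_subset_right.trans (Set.biInter_subset_of_mem hA) :
        Xset ∩ ⋂ A ∈ S, A.1 ⊆ A.1),
     fun B hB => Set.subset_inter B.2.1 (Set.subset_iInter₂ fun A hA => hB hA)⟩)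

end StableS

end FO

end PaperCore

namespace PaperCore
section Modal
variable {X Y : Type*}

/-- `□A = {x ∈ X : ρA ⊆ T[x,−]}`. -/
def box (R T : X → Y → Prop) (A : Set X) : Set X := {x | rho R A ⊆ {y | T x y}}

/-- `◇A = λ{y ∈ Y : A ⊆ T[−,y]}`. -/
def dia (R T : X → Y → Prop) (A : Set X) : Set X := lam R {y | A ⊆ {x | T x y}}

end Modal
end PaperCore

namespace PaperCore
section Adjunction
variable {X Y : Type*} {R T : X → Y → Prop}

lemma rho_dia_subset (hT : ∀ x : X, IsStableY R {y | T x y}) (A : Set X) :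
    rho R (dia R T A) ⊆ {y | A ⊆ {x | T x y}} := fun _ hy x hx =>
  have h : {z | A ⊆ {x | T x z}} ⊆ {z | T x z} := fun _ hz => hz hx
  hT x (rho_anti (lam_anti h) hy)

lemma dia_subset_iff_subset_box (hT : ∀ x : X, IsStableY R {y | T x y}) {A B : Set X}
    (hB : IsStable R B) : dia R T A ⊆ B ↔ A ⊆ box R T B :=
  ⟨fun h _ hx _ hy => rho_dia_subset hT A (rho_anti h hy) hx,
    fun h => Set.Subset.trans (lam_anti fun _ hy _ hx => h hx hy) hB⟩

lemma rho_iUnion_dia (hT1 : ∀ x : X, IsStableY R {y | T x y})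
    (hT2 : ∀ y : Y, IsStable R {x | T x y}) (G : Set (Set X)) :
    rho R (⋃ B ∈ G, dia R T B) = {y | lam R (rho R (⋃₀ G)) ⊆ {x | T x y}} := by
  ext y
  constructor
  · intro hy
    have h : ⋃₀ G ⊆ {x | T x y} := Set.sUnion_subset fun B hB =>
      rho_dia_subset hT1 B
        (rho_anti (Set.subset_biUnion_of_mem (u := fun B => dia R T B) hB) hy)
    exact (lamrho_mono h).trans (hT2 y)
  · intro hy x hx
    obtain ⟨B, hB, hxB⟩ := Set.mem_iUnion₂.1 hx
    exact hxB y fun z hz => hy fun w hw => hw z ⟨B, hB, hz⟩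

lemma dia_sUnion_closure (hT1 : ∀ x : X, IsStableY R {y | T x y})
    (hT2 : ∀ y : Y, IsStable R {x | T x y}) (G : Set (Set X)) :
    dia R T (lam R (rho R (⋃₀ G))) = lam R (rho R (⋃ B ∈ G, dia R T B)) := by
  rw [rho_iUnion_dia hT1 hT2, dia]

lemma box_mono {A B : Set X} (h : A ⊆ B) : box R T A ⊆ box R T B :=
  fun _ hx => (rho_anti h).trans hx

lemma box_sInter (hT : ∀ x : X, IsStableY R {y | T x y}) {G : Set (Set X)}
    (hG : ∀ B ∈ G, IsStable R B) : box R T (⋂₀ G) = ⋂ B ∈ G, box R T B := by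
  refine Set.Subset.antisymm
    (Set.subset_iInter₂ fun B hB => box_mono (Set.sInter_subset_of_mem hB)) fun x hx => ?_
  have h : lam R {y | T x y} ⊆ ⋂₀ G := Set.subset_sInter fun B hB =>
    (lam_anti (Set.mem_iInter₂.1 hx B hB)).trans (hG B hB)
  exact (rho_anti h).trans (hT x)

end Adjunction
end PaperCore

open PaperCore in
/-- `◇` is left adjoint to `□` on the stable set lattice; consequently `◇`
preserves arbitrary joins `⋁G = λρ(⋃G)` (a complete normal operator) and `□` preserves
arbitrary meets (intersections; a complete normal dual operator). -/
theorem statement16 {X Y : Type*} (R T : X → Y → Prop)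
    (hT1 : ∀ x : X, IsStableY R {y | T x y}) (hT2 : ∀ y : Y, IsStable R {x | T x y}) :
    (∀ A B : Set X, IsStable R A → IsStable R B → (dia R T A ⊆ B ↔ A ⊆ box R T B)) ∧
    (∀ G : Set (Set X), (∀ B ∈ G, IsStable R B) →
      dia R T (lam R (rho R (⋃₀ G))) = lam R (rho R (⋃ B ∈ G, dia R T B))) ∧
    (∀ G : Set (Set X), (∀ B ∈ G, IsStable R B) →
      box R T (⋂₀ G) = ⋂ B ∈ G, box R T B) :=
  ⟨fun _ _ _ hB => dia_subset_iff_subset_box hT1 hB,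
    fun G _ => dia_sUnion_closure hT1 hT2 G, fun _ hG => box_sInter hT1 hG⟩
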